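/- Let X be a uniform space whose uniformity is induced by a metric. If X is weakly chained, then X is uniformly joinable, i.e., every pair of points of X can be joined by a generalized path. -/

import Mathlib

/-! Basic definitions: chains, `E`-homotopy, generalized paths, and the
joinability properties of uniform spaces, following Brodskiy–Dydak–LaBuz–Mitra
and Plaut. -/

/-- A subset `A` of `X` is `E`-bounded if `A × A ⊆ E`. -/
def IsEBounded {X : Type*} (E : Set (X × X)) (A : Set X) : Prop :=
  ∀ a ∈ A, ∀ b ∈ A, (a, b) ∈ E

/-- A list of points is an `E`-chain if every pair of consecutive points
belongs to `E`. -/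
def IsEChain {X : Type*} (E : Set (X × X)) (c : List X) : Prop :=
  c.Chain' fun a b => (a, b) ∈ E

/-- `c` is an `E`-chain from `x` to `y`. -/
def IsEChainFromTo {X : Type*} (E : Set (X × X)) (c : List X) (x y : X) : Prop :=
  IsEChain E c ∧ c.head? = some x ∧ c.getLast? = some y

/-- A basic move inserts a single point `z` between two consecutive points
`a`, `b` of a chain, in such a way that `{a, z, b}` is `E`-bounded. -/
def BasicMove {X : Type*} (E : Set (X × X)) (c d : List X) : Prop :=
  ∃ (p q : List X) (a z b : X),
    IsEBounded E {a, z, b} ∧ c = p ++ a :: b :: q ∧ d = p ++ a :: z :: b :: q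

/-- Two `E`-chains are `E`-homotopic if one can be obtained from the other by a
finite sequence of basic moves (insertions or deletions); endpoints are kept
fixed automatically. -/
def EHomotopic {X : Type*} (E : Set (X × X)) : List X → List X → Prop :=
  Relation.EqvGen (BasicMove E)

/-- A generalized path from `x` to `y` in a uniform space `X`: a compatible
family of (`E`-homotopy classes of) `E`-chains from `x` to `y`, indexed by the
entourages `E` of `X`.  It is recorded by a choice of representative chain for
each entourage, such that for `F ⊆ E` the representative at `F` is
`E`-homotopic to the representative at `E` (this determines, and is determined
by, the family of homotopy classes). -/
structure GenPath {X : Type*} [UniformSpace X] (x y : X) where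
  /-- a representative `E`-chain for each entourage `E` -/
  chain : ∀ E : Set (X × X), E ∈ uniformity X → List X
  isChain : ∀ (E : Set (X × X)) (hE : E ∈ uniformity X),
    IsEChainFromTo E (chain E hE) x y
  compat : ∀ (F E : Set (X × X)) (hF : F ∈ uniformity X) (hE : E ∈ uniformity X),
    F ⊆ E → EHomotopic E (chain F hF) (chain E hE)

/-- A generalized path from `x` to `y` is `E`-short if its `E`-level homotopy
class is the class of the two-point chain `x, y`. -/
def GenPath.EShort {X : Type*} [UniformSpace X] {x y : X} (α : GenPath x y)
    (E : Set (X × X)) : Prop :=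
  ∀ hE : E ∈ uniformity X, EHomotopic E (α.chain E hE) [x, y]

/-- `X` is chain connected if for every entourage `E`, every pair of points of
`X` can be joined by an `E`-chain. -/
def ChainConnected (X : Type*) [UniformSpace X] : Prop :=
  ∀ E ∈ uniformity X, ∀ x y : X, ∃ c : List X, IsEChainFromTo E c x y

/-- `X` is uniformly joinable if every pair of points can be joined by a
generalized path. -/
def UniformlyJoinable (X : Type*) [UniformSpace X] : Prop :=
  ∀ x y : X, Nonempty (GenPath x y)

/-- `X` is locally uniformly joinable if for every entourage `E` there is an
entourage `F` such that any pair `(x, y) ∈ F` can be joined by an `E`-short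
generalized path. -/
def LocallyUniformlyJoinable (X : Type*) [UniformSpace X] : Prop :=
  ∀ E ∈ uniformity X, ∃ F ∈ uniformity X, ∀ x y : X, (x, y) ∈ F →
    ∃ α : GenPath x y, α.EShort E

/-- `X` is weakly chained if it is chain connected and for every entourage `E`
there is an entourage `F ⊆ E` such that every pair `(x, y) ∈ F` can be joined
by arbitrarily fine chains that are `E`-short (i.e. for every entourage `G`
there is a `G`-chain from `x` to `y` that is `E`-homotopic to the two-point
chain `x, y`). -/
def WeaklyChained (X : Type*) [UniformSpace X] : Prop :=
  ChainConnected X ∧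
    ∀ E ∈ uniformity X, ∃ F ∈ uniformity X, F ⊆ E ∧
      ∀ x y : X, (x, y) ∈ F → ∀ G ∈ uniformity X,
        ∃ c : List X, IsEChainFromTo G c x y ∧ EHomotopic E c [x, y]

namespace EHomotopic

variable {X : Type*} {E F : Set (X × X)} {c d : List X}

theorem mono (hEF : E ⊆ F) (h : EHomotopic E c d) : EHomotopic F c d := by
  refine Relation.EqvGen.mono ?_ _ _ h
  rintro _ _ ⟨p, q, a, z, b, hb, hc, hd⟩
  exact ⟨p, q, a, z, b, fun u hu v hv => hEF (hb u hu v hv), hc, hd⟩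

theorem append_append (p q : List X) (h : EHomotopic E c d) :
    EHomotopic E (p ++ c ++ q) (p ++ d ++ q) := by
  induction h with
  | rel _ _ h =>
    obtain ⟨p', q', a, z, b, hb, rfl, rfl⟩ := h
    exact .rel _ _ ⟨p ++ p', q' ++ q, a, z, b, hb, by simp, by simp⟩
  | refl _ => exact .refl _
  | symm _ _ _ ih => exact .symm _ _ ih
  | trans _ _ _ _ _ ih₁ ih₂ => exact .trans _ _ _ ih₁ ih₂

end EHomotopic

/-- Substituting for every link of an `F`-chain a `G`-chain that is `E`-short gives a
`G`-chain that is `E`-homotopic to the original chain. -/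
theorem IsEChainFromTo.exists_refinement {X : Type*} {E F G : Set (X × X)}
    (hF : ∀ x y : X, (x, y) ∈ F →
      ∃ c : List X, IsEChainFromTo G c x y ∧ EHomotopic E c [x, y])
    {c : List X} {x y : X} (hc : IsEChainFromTo F c x y) :
    ∃ d : List X, IsEChainFromTo G d x y ∧ EHomotopic E c d := by
  induction c generalizing x with
  | nil => simp [IsEChainFromTo] at hc
  | cons a l ih =>
    obtain ⟨hchain, hhead, hlast⟩ := hc
    obtain rfl : a = x := by simpa using hhead
    cases l with
    | nil => exact ⟨[a], ⟨List.isChain_singleton a, hhead, hlast⟩, .refl _⟩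
    | cons b l =>
      obtain ⟨hab, hbl⟩ := List.isChain_cons_cons.1 hchain
      obtain ⟨d, ⟨hd, hdhead, hdlast⟩, hld⟩ :=
        ih (x := b) ⟨hbl, rfl, by simpa using hlast⟩
      obtain ⟨t, rfl⟩ := List.head?_eq_some_iff.1 hdhead
      obtain ⟨e, ⟨he, hehead, helast⟩, hshort⟩ := hF a b hab
      obtain ⟨u, rfl⟩ := List.getLast?_eq_some_iff.1 helast
      refine ⟨u ++ b :: t, ⟨List.isChain_split.2 ⟨he, hd⟩, ?_, ?_⟩, ?_⟩
      · cases u <;> simpa using hehead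
      · rw [List.getLast?_append, hdlast]; rfl
      · have hprefix := hld.append_append [a] []
        have hlink := hshort.append_append [] t
        simp only [List.append_nil, List.nil_append, List.append_assoc,
          List.cons_append] at hprefix hlink
        exact .trans _ _ _ hprefix (.symm _ _ hlink)

/-- In a weakly chained space with countably generated uniformity, there is a decreasing base of
entourages `E n` such that the pairs in `E (n + 1)` are joined by arbitrarily fine `E n`-short
chains. -/
theorem WeaklyChained.exists_antitone_seq {X : Type*} [UniformSpace X]
    [(uniformity X).IsCountablyGenerated] (h : WeaklyChained X) :
    ∃ E : ℕ → Set (X × X), (∀ n, E n ∈ uniformity X) ∧ Antitone E ∧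
      (∀ V ∈ uniformity X, ∃ n, E n ⊆ V) ∧
      ∀ n, ∀ x y : X, (x, y) ∈ E (n + 1) → ∀ G ∈ uniformity X,
        ∃ c : List X, IsEChainFromTo G c x y ∧ EHomotopic (E n) c [x, y] := by
  obtain ⟨B, hB⟩ := (uniformity X).exists_antitone_basis
  choose! F hFmem hFsub hF using h.2
  let E : ℕ → Set (X × X) := Nat.rec Set.univ fun n V => F V ∩ B n
  have hE : ∀ n, E n ∈ uniformity X := by
    intro n
    induction n with
    | zero => exact Filter.univ_mem
    | succ n ih => exact Filter.inter_mem (hFmem _ ih) (hB.mem n)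
  refine ⟨E, hE, antitone_nat_of_succ_le fun n => ?_, fun V hV => ?_, fun n x y hxy => ?_⟩
  · exact Set.inter_subset_left.trans (hFsub _ (hE n))
  · obtain ⟨n, hn⟩ := hB.mem_iff.1 hV
    exact ⟨n + 1, Set.inter_subset_right.trans hn⟩
  · exact hF _ (hE n) x y hxy.1

/-- A sequence of chains from `x` to `y`, finer and finer with respect to a decreasing base of
entourages, whose consecutive terms are homotopic, determines a generalized path. -/
theorem GenPath.nonempty_of_seq {X : Type*} [UniformSpace X] {x y : X} {E : ℕ → Set (X × X)}
    (hanti : Antitone E) (hbasis : ∀ V ∈ uniformity X, ∃ n, E n ⊆ V) {c : ℕ → List X}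
    (hc : ∀ n, IsEChainFromTo (E n) (c n) x y)
    (hhom : ∀ n, EHomotopic (E n) (c n) (c (n + 1))) : Nonempty (GenPath x y) := by
  have hle : ∀ m n, m ≤ n → EHomotopic (E m) (c m) (c n) := by
    intro m n hmn
    induction n, hmn using Nat.le_induction with
    | base => exact .refl _
    | succ n hmn ih => exact .trans _ _ _ ih ((hhom n).mono (hanti hmn))
  choose N hN using hbasis
  refine ⟨⟨fun V hV => c (N V hV), fun V hV => ?_, fun V W hV hW hVW => ?_⟩⟩
  · exact ⟨(hc _).1.imp fun _ _ hab => hN V hV hab, (hc _).2⟩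
  · rcases le_total (N V hV) (N W hW) with hVW' | hWV'
    · exact (hle _ _ hVW').mono ((hN V hV).trans hVW)
    · exact .symm _ _ ((hle _ _ hWV').mono (hN W hW))

/-- A weakly chained metrizable uniform space is uniformly joinable: every pair
of points can be joined by a generalized path. -/
theorem weaklyChained_implies_uniformlyJoinable {X : Type*} [MetricSpace X]
    (h : WeaklyChained X) : UniformlyJoinable X := by
  intro x y
  obtain ⟨E, hE, hanti, hbasis, hshort⟩ := h.exists_antitone_seq
  have hstep : ∀ (n : ℕ) (d : List X), IsEChainFromTo (E (n + 1)) d x y →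
      ∃ d' : List X, IsEChainFromTo (E (n + 2)) d' x y ∧ EHomotopic (E n) d d' :=
    fun n _ hd => hd.exists_refinement fun a b hab => hshort n a b hab _ (hE (n + 2))
  choose! f hf hhom using hstep
  obtain ⟨d₀, hd₀⟩ := h.1 (E 1) (hE 1) x y
  let c : ℕ → List X := Nat.rec d₀ f
  have hc : ∀ n, IsEChainFromTo (E (n + 1)) (c n) x y := by
    intro n
    induction n with
    | zero => exact hd₀
    | succ n ih => exact hf n _ ih
  exact GenPath.nonempty_of_seq hanti hbasis
    (fun n => ⟨(hc n).1.imp fun _ _ hab => hanti n.le_succ hab, (hc n).2⟩)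
    fun n => hhom n _ (hc n)
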